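/- Let K be an algebraically closed field of characteristic 2 and n ≥ 3. Consider o_Π(2n), the Lie algebra of 2n×2n matrices over K preserving the form Π_{2n}, which consists of all block matrices [[A,B],[C,Aᵀ]] with A ∈ gl(n,K) and B, C symmetric n×n matrices. Then: (i) o_Π^(1)(2n) consists of all such matrices with B and C symmetric zero-diagonal; (ii) o_Π^(2)(2n) consists of all matrices from o_Π^(1)(2n) with tr A = 0; (iii) o_Π^(3)(2n) = o_Π^(2)(2n). -/

import Mathlib

open Matrix

/-- The derived space `[p, p]`: the span of all commutators of elements of `p`. -/
def commSpan (K : Type*) [Field K] {m : Type*} [Fintype m]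
    (p : Submodule K (Matrix m m K)) : Submodule K (Matrix m m K) :=
  Submodule.span K {z | ∃ x ∈ p, ∃ y ∈ p, z = x * y - y * x}

/-- The form `Π_{2n} = [[0,1ₙ],[1ₙ,0]]`. -/
def PiForm (K : Type*) [Field K] (n : ℕ) : Matrix (Fin n ⊕ Fin n) (Fin n ⊕ Fin n) K :=
  Matrix.fromBlocks 0 1 1 0

/-- The Lie algebra `o_Π(2n) = {X ∈ gl(2n,K) : X Π_{2n} + Π_{2n} Xᵀ = 0}`, as a subspace. -/
def oPi (K : Type*) [Field K] (n : ℕ) :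
    Submodule K (Matrix (Fin n ⊕ Fin n) (Fin n ⊕ Fin n) K) where
  carrier := {X | X * PiForm K n + PiForm K n * Xᵀ = 0}
  add_mem' := by
    intro a b ha hb
    simp only [Set.mem_setOf_eq] at *
    rw [Matrix.add_mul, Matrix.transpose_add, Matrix.mul_add]
    have h : a * PiForm K n + b * PiForm K n + (PiForm K n * aᵀ + PiForm K n * bᵀ) =
        (a * PiForm K n + PiForm K n * aᵀ) + (b * PiForm K n + PiForm K n * bᵀ) := by abel
    rw [h, ha, hb, add_zero]
  zero_mem' := by simp
  smul_mem' := by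
    intro c a ha
    simp only [Set.mem_setOf_eq] at *
    rw [Matrix.smul_mul, Matrix.transpose_smul, Matrix.mul_smul, ← smul_add, ha, smul_zero]

section ZeroDiagonalBlocks

variable {K : Type*} [Field K] {n : ℕ}

theorem commSpan_mono {m : Type*} [Fintype m] {p q : Submodule K (Matrix m m K)} (h : p ≤ q) :
    commSpan K p ≤ commSpan K q :=
  Submodule.span_mono fun _ ⟨x, hx, y, hy, hz⟩ => ⟨x, h hx, y, h hy, hz⟩

theorem commutator_mem_commSpan {m : Type*} [Fintype m] {p : Submodule K (Matrix m m K)}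
    {x y z : Matrix m m K} (hx : x ∈ p) (hy : y ∈ p) (hz : x * y - y * x = z) :
    z ∈ commSpan K p :=
  Submodule.subset_span ⟨x, hx, y, hy, hz.symm⟩

/-- The block matrices `[[A,B],[C,Aᵀ]]` with `A ∈ p` and `B`, `C` symmetric zero-diagonal. -/
def zeroDiagBlocks (p : Submodule K (Matrix (Fin n) (Fin n) K)) :
    Submodule K (Matrix (Fin n ⊕ Fin n) (Fin n ⊕ Fin n) K) where
  carrier := {X | ∃ A B C : Matrix (Fin n) (Fin n) K, B.IsSymm ∧ (∀ i, B i i = 0) ∧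
    C.IsSymm ∧ (∀ i, C i i = 0) ∧ A ∈ p ∧ X = fromBlocks A B C Aᵀ}
  add_mem' := by
    rintro _ _ ⟨A, B, C, hB, hB0, hC, hC0, hA, rfl⟩ ⟨A', B', C', hB', hB0', hC', hC0', hA', rfl⟩
    exact ⟨A + A', B + B', C + C', hB.add hB', by simp [hB0, hB0'], hC.add hC',
      by simp [hC0, hC0'], p.add_mem hA hA', by simp [fromBlocks_add]⟩
  zero_mem' := ⟨0, 0, 0, by simp, by simp, by simp, by simp, p.zero_mem, by simp⟩
  smul_mem' := by
    rintro c _ ⟨A, B, C, hB, hB0, hC, hC0, hA, rfl⟩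
    exact ⟨c • A, c • B, c • C, hB.smul c, by simp [hB0], hC.smul c, by simp [hC0],
      p.smul_mem c hA, by simp [fromBlocks_smul]⟩

theorem fromBlocks_mem_zeroDiagBlocks {p : Submodule K (Matrix (Fin n) (Fin n) K)}
    {A B C : Matrix (Fin n) (Fin n) K} (hA : A ∈ p) (hB : B.IsSymm) (hB0 : ∀ i, B i i = 0)
    (hC : C.IsSymm) (hC0 : ∀ i, C i i = 0) :
    fromBlocks A B C Aᵀ ∈ zeroDiagBlocks p :=
  ⟨A, B, C, hB, hB0, hC, hC0, hA, rfl⟩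

theorem zeroDiagBlocks_mono {p q : Submodule K (Matrix (Fin n) (Fin n) K)} (h : p ≤ q) :
    zeroDiagBlocks p ≤ zeroDiagBlocks q :=
  fun _ ⟨A, B, C, hB, hB0, hC, hC0, hA, hX⟩ => ⟨A, B, C, hB, hB0, hC, hC0, h hA, hX⟩

/-- The space of trace-zero matrices. -/
abbrev traceZero (K : Type*) [Field K] (n : ℕ) : Submodule K (Matrix (Fin n) (Fin n) K) :=
  LinearMap.ker (traceLinearMap (Fin n) K K)

theorem sum_smul_single (M : Matrix (Fin n) (Fin n) K) :
    ∑ i, ∑ j, M i j • single i j (1 : K) = M := by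
  conv_rhs => rw [matrix_eq_sum_single M]
  simp

theorem linearMap_mem_of_zero_diag {V : Type*} [AddCommGroup V] [Module K V]
    (f : Matrix (Fin n) (Fin n) K →ₗ[K] V) {W : Submodule K V}
    (h : ∀ i j, i ≠ j → f (single i j 1) ∈ W)
    {M : Matrix (Fin n) (Fin n) K} (hM : ∀ i, M i i = 0) : f M ∈ W := by
  rw [← sum_smul_single M, map_sum]
  refine W.sum_mem fun i _ => ?_
  rw [map_sum]
  refine W.sum_mem fun j _ => ?_
  rw [map_smul]
  rcases eq_or_ne i j with rfl | hij
  · simp [hM]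
  · exact W.smul_mem _ (h i j hij)

theorem linearMap_mem_of_trace_eq_zero {V : Type*} [AddCommGroup V] [Module K V]
    (f : Matrix (Fin n) (Fin n) K →ₗ[K] V) {W : Submodule K V} (k : Fin n)
    (h : ∀ i j, i ≠ j → f (single i j 1) ∈ W)
    (hk : ∀ i, i ≠ k → f (single i i 1 - single k k 1) ∈ W)
    {M : Matrix (Fin n) (Fin n) K} (hM : M.trace = 0) : f M ∈ W := by
  have key : M = (M - diagonal M.diag) + ∑ i, M i i • (single i i (1 : K) - single k k 1) := by
    simp only [smul_sub, Finset.sum_sub_distrib, ← Finset.sum_smul]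
    have h1 : ∑ i, M i i = 0 := hM
    have h2 : ∑ i, M i i • single i i (1 : K) = diagonal M.diag := by
      rw [← sum_single_eq_diagonal]; simp
    rw [h1, h2]; simp
  rw [key, map_add, map_sum]
  refine W.add_mem (linearMap_mem_of_zero_diag f h (by simp)) (W.sum_mem fun i _ => ?_)
  rw [map_smul]
  rcases eq_or_ne i k with rfl | hik
  · simp
  · exact W.smul_mem _ (hk i hik)

theorem exists_eq_add_transpose {B : Matrix (Fin n) (Fin n) K} (hB : B.IsSymm)
    (hB0 : ∀ i, B i i = 0) :
    ∃ U : Matrix (Fin n) (Fin n) K, (∀ i, U i i = 0) ∧ B = U + Uᵀ := by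
  refine ⟨of fun i j => if i < j then B i j else 0, by simp, ?_⟩
  ext i j
  rcases lt_trichotomy i j with h | rfl | h
  · simp [h, h.not_gt]
  · simp [hB0]
  · simp [h, h.not_gt, hB.apply]

theorem mem_oPi_of_fromBlocks [CharP K 2] {A B C : Matrix (Fin n) (Fin n) K} (hB : B.IsSymm)
    (hC : C.IsSymm) : fromBlocks A B C Aᵀ ∈ oPi K n := by
  change _ * _ + _ * _ = 0
  simp only [PiForm, fromBlocks_multiply, fromBlocks_transpose, fromBlocks_add, hB.eq, hC.eq]
  ext (i | i) (j | j) <;> simp [CharTwo.add_self_eq_zero]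

theorem exists_fromBlocks_of_mem_oPi [CharP K 2] {X : Matrix (Fin n ⊕ Fin n) (Fin n ⊕ Fin n) K}
    (hX : X ∈ oPi K n) : ∃ A B C : Matrix (Fin n) (Fin n) K,
      B.IsSymm ∧ C.IsSymm ∧ X = fromBlocks A B C Aᵀ := by
  obtain ⟨A, B, C, D, rfl⟩ : ∃ A B C D, X = fromBlocks A B C D :=
    ⟨_, _, _, _, (fromBlocks_toBlocks X).symm⟩
  change _ * _ + _ * _ = 0 at hX
  simp only [PiForm, fromBlocks_multiply, fromBlocks_transpose, fromBlocks_add,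
    ← fromBlocks_zero, fromBlocks_inj] at hX
  simp only [mul_zero, mul_one, zero_mul, one_mul, zero_add, add_zero] at hX
  obtain ⟨h1, -, h3, h4⟩ := hX
  have cancel : ∀ {M N : Matrix (Fin n) (Fin n) K}, M + N = 0 → N = M := by
    intro M N h
    ext i j
    exact (CharTwo.add_eq_zero.mp (congrFun₂ h i j)).symm
  exact ⟨A, B, C, cancel h1, cancel h4, by rw [cancel h3]⟩

theorem fromBlocks_commutator [CharP K 2] {A B C A' B' C' : Matrix (Fin n) (Fin n) K}
    (hB : B.IsSymm) (hC : C.IsSymm) (hB' : B'.IsSymm) (hC' : C'.IsSymm) :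
    fromBlocks A B C Aᵀ * fromBlocks A' B' C' A'ᵀ - fromBlocks A' B' C' A'ᵀ * fromBlocks A B C Aᵀ =
      fromBlocks (A * A' - A' * A + (B * C' - B' * C))
        ((A * B' - A' * B) + (A * B' - A' * B)ᵀ) ((C * A' - C' * A) + (C * A' - C' * A)ᵀ)
        (A * A' - A' * A + (B * C' - B' * C))ᵀ := by
  simp only [fromBlocks_multiply, transpose_sub, transpose_add, transpose_mul, hB.eq, hC.eq,
    hB'.eq, hC'.eq]
  ext (i | i) (j | j) <;> simp [CharTwo.sub_eq_add] <;> ring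

theorem commutator_mem_zeroDiagBlocks [CharP K 2] {A B C A' B' C' : Matrix (Fin n) (Fin n) K}
    {p : Submodule K (Matrix (Fin n) (Fin n) K)}
    (hB : B.IsSymm) (hC : C.IsSymm) (hB' : B'.IsSymm) (hC' : C'.IsSymm)
    (hp : A * A' - A' * A + (B * C' - B' * C) ∈ p) :
    fromBlocks A B C Aᵀ * fromBlocks A' B' C' A'ᵀ - fromBlocks A' B' C' A'ᵀ * fromBlocks A B C Aᵀ ∈
      zeroDiagBlocks p := by
  rw [fromBlocks_commutator hB hC hB' hC']
  exact fromBlocks_mem_zeroDiagBlocks hp (isSymm_add_transpose_self _)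
    (fun i => CharTwo.add_self_eq_zero _) (isSymm_add_transpose_self _)
    (fun i => CharTwo.add_self_eq_zero _)

theorem commSpan_oPi_le [CharP K 2] : commSpan K (oPi K n) ≤ zeroDiagBlocks ⊤ := by
  refine Submodule.span_le.mpr ?_
  rintro _ ⟨x, hx, y, hy, rfl⟩
  obtain ⟨A, B, C, hB, hC, rfl⟩ := exists_fromBlocks_of_mem_oPi hx
  obtain ⟨A', B', C', hB', hC', rfl⟩ := exists_fromBlocks_of_mem_oPi hy
  exact commutator_mem_zeroDiagBlocks hB hC hB' hC' trivial

theorem trace_mul_eq_zero_of_isSymm_of_zero_diag [CharP K 2] {B C : Matrix (Fin n) (Fin n) K}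
    (hB : B.IsSymm) (hB0 : ∀ i, B i i = 0) (hC : C.IsSymm) : (B * C).trace = 0 := by
  obtain ⟨U, -, rfl⟩ := exists_eq_add_transpose hB hB0
  have h : (Uᵀ * C).trace = (U * C).trace := by
    rw [← trace_transpose, transpose_mul, transpose_transpose, hC.eq, trace_mul_comm]
  rw [add_mul, trace_add, h, CharTwo.add_self_eq_zero]

theorem commSpan_zeroDiagBlocks_le [CharP K 2] (p : Submodule K (Matrix (Fin n) (Fin n) K)) :
    commSpan K (zeroDiagBlocks p) ≤ zeroDiagBlocks (traceZero K n) := by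
  refine Submodule.span_le.mpr ?_
  rintro _ ⟨_, ⟨A, B, C, hB, hB0, hC, hC0, -, rfl⟩, _, ⟨A', B', C', hB', hB0', hC', hC0', -, rfl⟩,
    rfl⟩
  refine commutator_mem_zeroDiagBlocks hB hC hB' hC' ?_
  simp [trace_mul_comm A A', trace_mul_eq_zero_of_isSymm_of_zero_diag hB hB0 hC',
    trace_mul_eq_zero_of_isSymm_of_zero_diag hB' hB0' hC]

/-- The embedding `A ↦ [[A,0],[0,Aᵀ]]`. -/
def diagBlock : Matrix (Fin n) (Fin n) K →ₗ[K] Matrix (Fin n ⊕ Fin n) (Fin n ⊕ Fin n) K where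
  toFun A := fromBlocks A 0 0 Aᵀ
  map_add' A A' := by simp [fromBlocks_add]
  map_smul' c A := by simp [fromBlocks_smul]

theorem diagBlock_apply (A : Matrix (Fin n) (Fin n) K) : diagBlock A = fromBlocks A 0 0 Aᵀ := rfl

/-- The map `U ↦ [[0,U + Uᵀ],[0,0]]`. -/
def upperBlock : Matrix (Fin n) (Fin n) K →ₗ[K] Matrix (Fin n ⊕ Fin n) (Fin n ⊕ Fin n) K where
  toFun U := fromBlocks 0 (U + Uᵀ) 0 0
  map_add' U U' := by simp [fromBlocks_add]; abel
  map_smul' c U := by simp [fromBlocks_smul]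

theorem upperBlock_apply (U : Matrix (Fin n) (Fin n) K) :
    upperBlock U = fromBlocks 0 (U + Uᵀ) 0 0 := rfl

/-- The map `U ↦ [[0,0],[U + Uᵀ,0]]`. -/
def lowerBlock : Matrix (Fin n) (Fin n) K →ₗ[K] Matrix (Fin n ⊕ Fin n) (Fin n ⊕ Fin n) K where
  toFun U := fromBlocks 0 0 (U + Uᵀ) 0
  map_add' U U' := by simp [fromBlocks_add]; abel
  map_smul' c U := by simp [fromBlocks_smul]

theorem lowerBlock_apply (U : Matrix (Fin n) (Fin n) K) :
    lowerBlock U = fromBlocks 0 0 (U + Uᵀ) 0 := rfl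

theorem diagBlock_mem_zeroDiagBlocks {p : Submodule K (Matrix (Fin n) (Fin n) K)}
    {A : Matrix (Fin n) (Fin n) K} (hA : A ∈ p) : diagBlock A ∈ zeroDiagBlocks p :=
  fromBlocks_mem_zeroDiagBlocks hA (by simp) (by simp) (by simp) (by simp)

theorem upperBlock_mem_zeroDiagBlocks [CharP K 2] (p : Submodule K (Matrix (Fin n) (Fin n) K))
    (U : Matrix (Fin n) (Fin n) K) : upperBlock U ∈ zeroDiagBlocks p :=
  ⟨0, U + Uᵀ, 0, isSymm_add_transpose_self _, fun i => CharTwo.add_self_eq_zero _, by simp,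
    by simp, p.zero_mem, by simp [upperBlock_apply]⟩

theorem lowerBlock_mem_zeroDiagBlocks [CharP K 2] (p : Submodule K (Matrix (Fin n) (Fin n) K))
    (U : Matrix (Fin n) (Fin n) K) : lowerBlock U ∈ zeroDiagBlocks p :=
  ⟨0, 0, U + Uᵀ, by simp, by simp, isSymm_add_transpose_self _,
    fun i => CharTwo.add_self_eq_zero _, p.zero_mem, by simp [lowerBlock_apply]⟩

theorem diagBlock_commutator [CharP K 2] (A A' : Matrix (Fin n) (Fin n) K) :
    diagBlock A * diagBlock A' - diagBlock A' * diagBlock A = diagBlock (A * A' - A' * A) := by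
  have h := fromBlocks_commutator (A := A) (A' := A') (B := 0) (C := 0) (B' := 0) (C' := 0)
    (by simp) (by simp) (by simp) (by simp)
  simpa [diagBlock_apply] using h

theorem diagBlock_upperBlock_commutator [CharP K 2] (A U : Matrix (Fin n) (Fin n) K) :
    diagBlock A * upperBlock U - upperBlock U * diagBlock A = upperBlock (A * (U + Uᵀ)) := by
  have h := fromBlocks_commutator (A := A) (A' := 0) (B := 0) (C := 0) (B' := U + Uᵀ) (C' := 0)
    (by simp) (by simp) (isSymm_add_transpose_self _) (by simp)
  simpa [diagBlock_apply, upperBlock_apply] using h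

theorem lowerBlock_diagBlock_commutator [CharP K 2] (A U : Matrix (Fin n) (Fin n) K) :
    lowerBlock U * diagBlock A - diagBlock A * lowerBlock U = lowerBlock ((U + Uᵀ) * A) := by
  have h := fromBlocks_commutator (A := 0) (A' := A) (B := 0) (C := U + Uᵀ) (B' := 0) (C' := 0)
    (by simp) (isSymm_add_transpose_self _) (by simp) (by simp)
  simpa [diagBlock_apply, lowerBlock_apply] using h

theorem exists_ne_ne (hn : 3 ≤ n) (i j : Fin n) : ∃ k, k ≠ i ∧ k ≠ j := by
  obtain ⟨k, hk⟩ := Finset.exists_mem_notMem_of_card_lt_card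
    (s := {i, j}) (t := (Finset.univ : Finset (Fin n)))
    (lt_of_le_of_lt Finset.card_le_two (by simp; omega))
  exact ⟨k, by simpa using hk⟩

theorem zeroDiagBlocks_traceZero_le [CharP K 2] (hn : 3 ≤ n) :
    zeroDiagBlocks (traceZero K n) ≤ commSpan K (zeroDiagBlocks (traceZero K n)) := by
  rintro _ ⟨A, B, C, hB, hB0, hC, hC0, hA, rfl⟩
  obtain ⟨U, hU, rfl⟩ := exists_eq_add_transpose hB hB0
  obtain ⟨V, hV, rfl⟩ := exists_eq_add_transpose hC hC0
  have hsplit : fromBlocks A (U + Uᵀ) (V + Vᵀ) Aᵀ =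
      diagBlock A + upperBlock U + lowerBlock V := by
    simp [diagBlock_apply, upperBlock_apply, lowerBlock_apply, fromBlocks_add]
  rw [hsplit]
  have hoff : ∀ i j : Fin n, i ≠ j → diagBlock (single i j (1 : K)) ∈
      zeroDiagBlocks (traceZero K n) := fun i j hij =>
    diagBlock_mem_zeroDiagBlocks (by simp [trace_single_eq_of_ne _ _ _ hij])
  have hdiag : ∀ i k : Fin n, diagBlock (single i i (1 : K) - single k k 1) ∈
      zeroDiagBlocks (traceZero K n) := fun i k => diagBlock_mem_zeroDiagBlocks (by simp)
  refine Submodule.add_mem _ (Submodule.add_mem _ ?_ ?_) ?_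
  · refine linearMap_mem_of_trace_eq_zero diagBlock (⟨0, by omega⟩ : Fin n) (fun i j hij => ?_)
      (fun i hi => ?_) (by simpa using hA)
    · obtain ⟨k, hki, hkj⟩ := exists_ne_ne hn i j
      refine commutator_mem_commSpan (hoff i k hki.symm) (hoff k j hkj) ?_
      rw [diagBlock_commutator]
      simp [hij.symm]
    · refine commutator_mem_commSpan (hoff _ _ hi) (hoff _ _ hi.symm) ?_
      rw [diagBlock_commutator]
      simp
  · refine linearMap_mem_of_zero_diag upperBlock (fun i j hij => ?_) hU
    obtain ⟨k, hki, hkj⟩ := exists_ne_ne hn i j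
    refine commutator_mem_commSpan (hdiag i k)
      (upperBlock_mem_zeroDiagBlocks _ (single i j 1)) ?_
    rw [diagBlock_upperBlock_commutator]
    simp [sub_mul, mul_add, hij, hki, hkj]
  · refine linearMap_mem_of_zero_diag lowerBlock (fun i j hij => ?_) hV
    obtain ⟨k, hki, hkj⟩ := exists_ne_ne hn i j
    refine commutator_mem_commSpan (lowerBlock_mem_zeroDiagBlocks _ (single i j 1))
      (hdiag j k) ?_
    rw [lowerBlock_diagBlock_commutator]
    simp [mul_sub, add_mul, hij, hki.symm, hkj.symm]

theorem zeroDiagBlocks_le_oPi [CharP K 2] (p : Submodule K (Matrix (Fin n) (Fin n) K)) :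
    zeroDiagBlocks p ≤ oPi K n := by
  rintro _ ⟨A, B, C, hB, -, hC, -, -, rfl⟩
  exact mem_oPi_of_fromBlocks hB hC

theorem commSpan_oPi [CharP K 2] (hn : 3 ≤ n) : commSpan K (oPi K n) = zeroDiagBlocks ⊤ := by
  refine le_antisymm commSpan_oPi_le ?_
  rintro _ ⟨A, B, C, hB, hB0, hC, hC0, -, rfl⟩
  let k : Fin n := ⟨0, by omega⟩
  have hsplit : fromBlocks A B C Aᵀ =
      fromBlocks (A - A.trace • single k k 1) B C (A - A.trace • single k k 1)ᵀ +
        A.trace • diagBlock (single k k 1) := by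
    simp [diagBlock_apply, fromBlocks_add, fromBlocks_smul]
  rw [hsplit]
  refine Submodule.add_mem _ (commSpan_mono (zeroDiagBlocks_le_oPi _)
    (zeroDiagBlocks_traceZero_le hn (fromBlocks_mem_zeroDiagBlocks ?_ hB hB0 hC hC0)))
    (Submodule.smul_mem _ _ ?_)
  · simp
  · have hs : (single k k (1 : K)).IsSymm := by simp [IsSymm]
    have h := fromBlocks_commutator (A := 0) (A' := 0) (C := 0) (B' := 0) hs isSymm_zero
      isSymm_zero hs
    refine commutator_mem_commSpan (mem_oPi_of_fromBlocks hs isSymm_zero)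
      (mem_oPi_of_fromBlocks isSymm_zero hs) (h.trans ?_)
    simp [diagBlock_apply]

theorem commSpan_zeroDiagBlocks [CharP K 2] (hn : 3 ≤ n)
    {p : Submodule K (Matrix (Fin n) (Fin n) K)} (hp : traceZero K n ≤ p) :
    commSpan K (zeroDiagBlocks p) = zeroDiagBlocks (traceZero K n) :=
  le_antisymm (commSpan_zeroDiagBlocks_le p)
    ((zeroDiagBlocks_traceZero_le hn).trans (commSpan_mono (zeroDiagBlocks_mono hp)))

end ZeroDiagonalBlocks

/-- Over an algebraically closed field of characteristic 2 and for `n ≥ 3`: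
(i) `o_Π⁽¹⁾(2n)` consists of the block matrices `[[A,B],[C,Aᵀ]]` with `B, C` symmetric
zero-diagonal; (ii) `o_Π⁽²⁾(2n)` consists of those, in addition, with `tr A = 0`;
(iii) `o_Π⁽³⁾(2n) = o_Π⁽²⁾(2n)`. -/
theorem derived_oPi_description
    (K : Type*) [Field K] [IsAlgClosed K] [CharP K 2] (n : ℕ) (hn : 3 ≤ n) :
    ((commSpan K (oPi K n) : Set (Matrix (Fin n ⊕ Fin n) (Fin n ⊕ Fin n) K)) =
      {X | ∃ A B C : Matrix (Fin n) (Fin n) K, B.IsSymm ∧ (∀ i, B i i = 0) ∧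
        C.IsSymm ∧ (∀ i, C i i = 0) ∧ X = Matrix.fromBlocks A B C Aᵀ}) ∧
    ((commSpan K (commSpan K (oPi K n)) :
        Set (Matrix (Fin n ⊕ Fin n) (Fin n ⊕ Fin n) K)) =
      {X | ∃ A B C : Matrix (Fin n) (Fin n) K, B.IsSymm ∧ (∀ i, B i i = 0) ∧
        C.IsSymm ∧ (∀ i, C i i = 0) ∧ A.trace = 0 ∧ X = Matrix.fromBlocks A B C Aᵀ}) ∧
    commSpan K (commSpan K (commSpan K (oPi K n))) = commSpan K (commSpan K (oPi K n)) := by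
  rw [commSpan_oPi hn, commSpan_zeroDiagBlocks hn le_top, commSpan_zeroDiagBlocks hn le_rfl]
  refine ⟨?_, ?_, rfl⟩
  · ext X
    simp [zeroDiagBlocks]
  · ext X
    simp [zeroDiagBlocks]
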